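/- Let n ≥ 2, let a ∈ (0,1), and let p(z) = (z−a)·∏_{k=1}^{n−1}(z−z_k) with |z_k| ≤ 1 for all k. Suppose every zero ζ of p′ satisfies |ζ − a| ≥ 1. Then for every real λ with 0 < λ ≤ sin(π/n) and every complex z with |z − a| = λ, one has |p(z)| > 1 − (1 − λ)^n. -/

import Mathlib

open Polynomial Real Complex

/-- A convex combination of `1` and `(1 - u)⁻¹` lies in a sector bounded by the direction of `1`
and a direction at angle at most `θ`, when `‖u‖ ≤ sin θ`. -/
theorem exists_sector_one_sub_inv {θ : ℝ} (hθ0 : 0 ≤ θ) (hθ : θ < π / 2) {u : ℂ}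
    (hu : ‖u‖ ≤ Real.sin θ) :
    ∃ A B : ℝ, 0 ≤ A ∧ 0 ≤ B ∧ A + B ≤ θ ∧ ∀ t ∈ Set.Icc (0 : ℝ) 1,
      ∃ r φ : ℝ, 0 < r ∧ -B ≤ φ ∧ φ ≤ A ∧
        (1 - t * u) / (1 - u) = r * Complex.exp (φ * Complex.I) := by
  have hs1 : Real.sin θ < 1 := by
    rw [← Real.sin_pi_div_two]
    exact Real.sin_lt_sin_of_lt_of_le_pi_div_two (by linarith) le_rfl hθ
  have hs0 : 0 ≤ Real.sin θ := (norm_nonneg u).trans hu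
  have hre : u.re < 1 := ((Complex.re_le_norm u).trans hu).trans_lt hs1
  have hnz : (1 - u) ≠ 0 := by
    intro h
    have := congrArg Complex.re h
    simp at this
    linarith
  set v : ℂ := (1 - u)⁻¹ with hv
  have hN : 0 < Complex.normSq (1 - u) := Complex.normSq_pos.mpr hnz
  have hvre : 0 < v.re := by
    rw [hv, Complex.inv_re]
    simp only [Complex.sub_re, Complex.one_re]
    exact div_pos (by linarith) hN
  have harg : |v.arg| ≤ θ := by
    rw [hv, Complex.abs_arg_inv, Complex.arg_of_re_nonneg (by simp; linarith), abs_le]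
    have hn : 0 < ‖1 - u‖ := norm_pos_iff.mpr hnz
    have key : |(1 - u).im / ‖1 - u‖| ≤ Real.sin θ := by
      rw [abs_div, abs_norm, div_le_iff₀ hn]
      have hu2 : u.re ^ 2 + u.im ^ 2 ≤ Real.sin θ ^ 2 := by
        have := pow_le_pow_left₀ (norm_nonneg u) hu 2
        rw [← Complex.normSq_eq_norm_sq, Complex.normSq_apply] at this
        linarith
      have hsq : Real.sin θ ^ 2 ≤ 1 := by nlinarith
      refine abs_le_of_sq_le_sq ?_ (by positivity)
      rw [mul_pow, ← Complex.normSq_eq_norm_sq, Complex.normSq_apply]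
      simp only [Complex.sub_re, Complex.one_re, Complex.sub_im, Complex.one_im]
      nlinarith [sq_nonneg (u.re - Real.sin θ ^ 2),
        mul_le_mul_of_nonneg_right hu2 (sub_nonneg.mpr hsq)]
    rw [abs_le] at key
    exact ⟨by rw [Real.le_arcsin_iff_sin_le' ⟨by linarith, by linarith⟩, Real.sin_neg]; exact key.1,
      Real.arcsin_le_iff_le_sin' ⟨by linarith, hθ⟩ |>.mpr key.2⟩
  have hx : ∀ t ∈ Set.Icc (0 : ℝ) 1, (1 - t * u) / (1 - u) = t + (1 - t) * v := by
    intro t _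
    rw [hv]; field_simp; ring
  have hxre : ∀ t ∈ Set.Icc (0 : ℝ) 1, 0 < ((t : ℂ) + (1 - t) * v).re := by
    intro t ht
    have : ((t : ℂ) + (1 - t) * v).re = t + (1 - t) * v.re := by simp
    rw [this]
    rcases eq_or_lt_of_le ht.1 with h | h
    · rw [← h]; simpa using hvre
    · nlinarith [ht.2, mul_nonneg (sub_nonneg.mpr ht.2) hvre.le]
  have hat : ∀ x : ℂ, 0 < x.re → x.arg = Real.arctan (x.im / x.re) := by
    intro x hx
    rw [← Complex.tan_arg, Real.arctan_tan]
    · exact (abs_lt.mp (Complex.abs_arg_lt_pi_div_two_iff.mpr (Or.inl hx))).1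
    · exact (abs_lt.mp (Complex.abs_arg_lt_pi_div_two_iff.mpr (Or.inl hx))).2
  refine ⟨max v.arg 0, max (-v.arg) 0, le_max_right _ _, le_max_right _ _, ?_, ?_⟩
  · rcases le_total 0 v.arg with h | h
    · rw [max_eq_left h, max_eq_right (by linarith), add_zero]
      exact (le_abs_self _).trans harg
    · rw [max_eq_right h, max_eq_left (by linarith), zero_add]
      exact (neg_le_abs _).trans harg
  · intro t ht
    have h1 := hxre t ht
    set x : ℂ := (t : ℂ) + (1 - t) * v with hxdef
    have hxim : x.im = (1 - t) * v.im := by simp [hxdef]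
    have hxre' : x.re = t + (1 - t) * v.re := by simp [hxdef]
    have hbd : ∀ y : ℝ, (1 - t) * y / x.re ≤ max (y / v.re) 0 := by
      intro y
      rcases le_total 0 y with h | h
      · refine le_max_of_le_left ?_
        rw [div_le_div_iff₀ h1 hvre, hxre']
        nlinarith [mul_nonneg h ht.1]
      · refine le_max_of_le_right (div_nonpos_of_nonpos_of_nonneg ?_ h1.le)
        exact mul_nonpos_of_nonneg_of_nonpos (sub_nonneg.mpr ht.2) h
    have hpos : x.im / x.re ≤ max (v.im / v.re) 0 := hxim ▸ hbd v.im
    have hneg : -(x.im / x.re) ≤ max (-(v.im / v.re)) 0 := by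
      rw [hxim, ← neg_div, ← neg_div, ← mul_neg]
      exact hbd _
    refine ⟨‖x‖, x.arg, norm_pos_iff.mpr (by rintro h; simp [h] at h1), ?_, ?_, ?_⟩
    · rw [hat x h1, hat v hvre, neg_le, ← Real.arctan_neg, ← Real.arctan_neg]
      refine (Real.arctan_strictMono.monotone hneg).trans ?_
      rw [Real.arctan_strictMono.monotone.map_max, Real.arctan_zero]
    · rw [hat x h1, hat v hvre]
      refine (Real.arctan_strictMono.monotone hpos).trans ?_
      rw [Real.arctan_strictMono.monotone.map_max, Real.arctan_zero]
    · rw [hx t ht, Complex.norm_mul_exp_arg_mul_I]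

/-- A sector containing the products of ratios along a radius, of opening at most `S.card * θ`. -/
theorem exists_sector_prod {θ : ℝ} (hθ0 : 0 ≤ θ) (hθ : θ < π / 2) {w : ℂ}
    (hw : ‖w‖ ≤ Real.sin θ) (S : Multiset ℂ) (hS : ∀ ξ ∈ S, 1 ≤ ‖ξ‖) :
    ∃ A B : ℝ, 0 ≤ A ∧ 0 ≤ B ∧ A + B ≤ S.card * θ ∧ ∀ t ∈ Set.Icc (0 : ℝ) 1,
      ∃ r φ : ℝ, 0 < r ∧ -B ≤ φ ∧ φ ≤ A ∧
        (S.map fun ξ => t * w - ξ).prod / (S.map fun ξ => w - ξ).prod =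
          r * Complex.exp (φ * Complex.I) := by
  induction S using Multiset.induction with
  | empty =>
    refine ⟨0, 0, le_rfl, le_rfl, by simp, fun t _ => ⟨1, 0, one_pos, by simp, le_rfl, by simp⟩⟩
  | cons ξ S ih =>
    obtain ⟨A, B, hA, hB, hAB, H⟩ := ih fun η hη => hS η (Multiset.mem_cons_of_mem hη)
    have hξ : 1 ≤ ‖ξ‖ := hS ξ (Multiset.mem_cons_self _ _)
    have hξ0 : ξ ≠ 0 := by rintro rfl; norm_num at hξ
    obtain ⟨A', B', hA', hB', hAB', H'⟩ := exists_sector_one_sub_inv hθ0 hθ (u := w / ξ) (by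
      rw [norm_div]
      exact (div_le_self (norm_nonneg w) hξ).trans hw)
    refine ⟨A' + A, B' + B, by positivity, by positivity, ?_, fun t ht => ?_⟩
    · rw [Multiset.card_cons]; push_cast; linarith
    · obtain ⟨r, φ, hr, h1, h2, h3⟩ := H t ht
      obtain ⟨r', φ', hr', h1', h2', h3'⟩ := H' t ht
      refine ⟨r' * r, φ' + φ, by positivity, by linarith, by linarith, ?_⟩
      have : (t * w - ξ) / (w - ξ) = (1 - t * (w / ξ)) / (1 - w / ξ) := by
        rw [show t * w - ξ = (1 - t * (w / ξ)) * (-ξ) by field_simp; ring,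
          show w - ξ = (1 - w / ξ) * (-ξ) by field_simp; ring,
          mul_div_mul_right _ _ (neg_ne_zero.mpr hξ0)]
      rw [Multiset.map_cons, Multiset.map_cons, Multiset.prod_cons, Multiset.prod_cons,
        mul_div_mul_comm, h3, this, h3']
      push_cast
      rw [add_mul, Complex.exp_add]
      ring

/-- If the quotient of `f` by `w` times its derivative is real then it is positive, for `‖w‖ ≤ sin (π / n)`. -/
theorem re_pos_of_im_eq_zero {n : ℕ} (hn : 3 ≤ n) {f : ℂ → ℂ} {S : Multiset ℂ}
    (hcard : S.card = n - 1) (hS : ∀ ξ ∈ S, 1 ≤ ‖ξ‖) (hf0 : f 0 = 0)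
    (hf : ∀ t, HasDerivAt f (n * (S.map fun ξ => t - ξ).prod) t) {w : ℂ} (hw0 : w ≠ 0)
    (hw : ‖w‖ ≤ Real.sin (π / n))
    (him : (f w / (w * (n * (S.map fun ξ => w - ξ).prod))).im = 0) :
    0 < (f w / (w * (n * (S.map fun ξ => w - ξ).prod))).re := by
  have hn3 : (3 : ℝ) ≤ n := by exact_mod_cast hn
  have hn0 : (n : ℂ) ≠ 0 := by norm_cast; omega
  have hθ0 : 0 ≤ π / n := by positivity
  have hθ : π / n < π / 2 := by
    apply div_lt_div_of_pos_left Real.pi_pos (by norm_num); linarith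
  obtain ⟨A, B, hA, hB, hAB, H⟩ := exists_sector_prod hθ0 hθ hw S hS
  have hlt : A + B < π := by
    refine hAB.trans_lt ?_
    rw [hcard, Nat.cast_sub (by omega), mul_div_assoc', div_lt_iff₀ (by linarith)]
    push_cast
    nlinarith [Real.pi_pos]
  set D : ℂ := (S.map fun ξ => w - ξ).prod with hD
  set μ : ℝ := (A - B) / 2 with hμ
  set E : ℂ := Complex.exp (((-μ : ℝ) : ℂ) * Complex.I) with hE
  have hder : ∀ t : ℝ, HasDerivAt (fun t : ℝ => (E * (f (t * w) / (w * (n * D)))).re)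
      (E * ((S.map fun ξ => t * w - ξ).prod / D)).re t := by
    intro t
    have h1 : HasDerivAt (fun t : ℂ => E * (f (t * w) / (w * (n * D))))
        (E * ((S.map fun ξ => t * w - ξ).prod / D)) (t : ℂ) := by
      have := (((hf (t * w)).comp (t : ℂ) ((hasDerivAt_id (t : ℂ)).mul_const w)).div_const
        (w * (n * D))).const_mul E
      refine this.congr_deriv ?_
      rw [one_mul, mul_comm _ w, mul_div_mul_left _ _ hw0, mul_div_mul_left _ _ hn0]
    exact h1.real_of_complex
  have hmono : StrictMonoOn (fun t : ℝ => (E * (f (t * w) / (w * (n * D)))).re)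
      (Set.Icc 0 1) := by
    apply strictMonoOn_of_deriv_pos (convex_Icc 0 1)
      fun t _ => (hder t).continuousAt.continuousWithinAt
    intro t ht
    rw [interior_Icc] at ht
    rw [(hder t).deriv]
    obtain ⟨r, φ, hr, h1, h2, h3⟩ := H t ⟨ht.1.le, ht.2.le⟩
    rw [h3, hE, mul_left_comm, ← Complex.exp_add, ← add_mul, ← Complex.ofReal_add,
      Complex.re_ofReal_mul, Complex.exp_ofReal_mul_I_re]
    exact mul_pos hr (Real.cos_pos_of_mem_Ioo ⟨by linarith, by linarith⟩)
  have h01 := hmono (Set.left_mem_Icc.mpr zero_le_one) (Set.right_mem_Icc.mpr zero_le_one)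
    zero_lt_one
  simp only [Complex.ofReal_zero, zero_mul, hf0, zero_div, mul_zero, Complex.zero_re,
    Complex.ofReal_one, one_mul, Complex.mul_re, him, sub_zero] at h01
  have hE0 : 0 < E.re := by
    rw [hE, Complex.exp_ofReal_mul_I_re]
    exact Real.cos_pos_of_mem_Ioo ⟨by linarith, by linarith⟩
  exact pos_of_mul_pos_right h01 hE0.le

theorem pow_card_le_norm_prod {S : Multiset ℂ} {f : ℂ → ℂ} {m : ℝ} (hm : 0 ≤ m)
    (hf : ∀ ξ ∈ S, m ≤ ‖f ξ‖) : m ^ S.card ≤ ‖(S.map f).prod‖ := by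
  induction S using Multiset.induction with
  | empty => simp
  | cons ξ S ih =>
    rw [Multiset.card_cons, Multiset.map_cons, Multiset.prod_cons, norm_mul, pow_succ']
    exact mul_le_mul (hf ξ (Multiset.mem_cons_self _ _))
      (ih fun η hη => hf η (Multiset.mem_cons_of_mem hη)) (by positivity) (norm_nonneg _)

theorem norm_eq_of_norm_prod_le {S : Multiset ℂ} {f : ℂ → ℂ} {m : ℝ} (hm : 0 < m)
    (hf : ∀ ξ ∈ S, m ≤ ‖f ξ‖) (hprod : ‖(S.map f).prod‖ ≤ m ^ S.card) :
    ∀ ξ ∈ S, ‖f ξ‖ = m := by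
  intro ξ hξ
  obtain ⟨T, rfl⟩ := Multiset.exists_cons_of_mem hξ
  have h1 := pow_card_le_norm_prod hm.le fun η hη => hf η (Multiset.mem_cons_of_mem hη)
  rw [Multiset.card_cons, Multiset.map_cons, Multiset.prod_cons, norm_mul, pow_succ'] at hprod
  refine le_antisymm ?_ (hf ξ hξ)
  by_contra! h
  have h2 : 0 < m ^ T.card := by positivity
  nlinarith [mul_le_mul_of_nonneg_left h1 (norm_nonneg (f ξ)), mul_lt_mul_of_pos_right h h2]

/-- First-order conditions at a minimum of `‖f‖ - c (1 - (1 - ‖·‖) ^ n)` on a closed disc. -/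
theorem norm_deriv_le_of_isMinOn {n : ℕ} (hn : 3 ≤ n) {f : ℂ → ℂ} {S : Multiset ℂ}
    (hcard : S.card = n - 1) (hS : ∀ ξ ∈ S, 1 ≤ ‖ξ‖) (hf0 : f 0 = 0)
    (hf : ∀ t, HasDerivAt f (n * (S.map fun ξ => t - ξ).prod) t) {L : ℝ}
    (hL : L ≤ Real.sin (π / n)) {c : ℝ} {w : ℂ} (hw0 : w ≠ 0) (hw : ‖w‖ ≤ L)
    (hmin : ∀ v : ℂ, ‖v‖ ≤ L →
      ‖f w‖ - c * (1 - (1 - ‖w‖) ^ n) ≤ ‖f v‖ - c * (1 - (1 - ‖v‖) ^ n)) :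
    ‖(S.map fun ξ => w - ξ).prod‖ ≤ c * (1 - ‖w‖) ^ (n - 1) := by
  have hpos := re_pos_of_im_eq_zero hn hcard hS hf0 hf hw0 (hw.trans hL)
  have hwp : 0 < ‖w‖ := norm_pos_iff.mpr hw0
  have hnp : (0 : ℝ) < n := by norm_cast; omega
  set D : ℂ := (S.map fun ξ => w - ξ).prod with hD
  set Q : ℂ := w * (n * D) with hQ
  have hang : ((starRingEnd ℂ) (f w) * Q).im = 0 := by
    have h1 : HasDerivAt (fun θ : ℝ => f (w * Complex.exp (θ * Complex.I)))
        (Q * Complex.I) 0 := by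
      have h2 : HasDerivAt (fun θ : ℂ => w * Complex.exp (θ * Complex.I))
          (w * (Complex.exp (((0 : ℝ) : ℂ) * Complex.I) * (1 * Complex.I))) ((0 : ℝ) : ℂ) :=
        (((hasDerivAt_id _).mul_const Complex.I).cexp).const_mul w
      have h3 := ((hf (w * Complex.exp (((0 : ℝ) : ℂ) * Complex.I))).comp ((0 : ℝ) : ℂ) h2).comp_ofReal
      refine h3.congr_deriv ?_
      simp only [Complex.ofReal_zero, zero_mul, Complex.exp_zero, mul_one, one_mul, ← hD, hQ]
      ring
    have h2 := h1.norm_sq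
    have h3 : IsLocalMin (fun θ : ℝ => ‖f (w * Complex.exp (θ * Complex.I))‖ ^ 2) 0 := by
      refine Filter.Eventually.of_forall fun θ => ?_
      have hnv : ‖w * Complex.exp (θ * Complex.I)‖ = ‖w‖ := by
        rw [norm_mul, Complex.norm_exp_ofReal_mul_I, mul_one]
      have := hmin (w * Complex.exp (θ * Complex.I)) (hnv.le.trans hw)
      rw [hnv] at this
      simp only [Complex.ofReal_zero, zero_mul, Complex.exp_zero, mul_one]
      gcongr
      linarith
    have h4 := h3.hasDerivAt_eq_zero h2
    simp only [Complex.ofReal_zero, zero_mul, Complex.exp_zero, mul_one, Complex.inner] at h4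
    rw [mul_right_comm, Complex.mul_I_re, mul_comm Q] at h4
    linarith
  have hquot : f w / Q = (starRingEnd ℂ) ((starRingEnd ℂ) (f w) * Q) / (‖Q‖ ^ 2 : ℝ) := by
    rcases eq_or_ne Q 0 with h | h
    · simp [h]
    · rw [map_mul, Complex.conj_conj, Complex.ofReal_pow, ← Complex.mul_conj']
      have : (starRingEnd ℂ) Q ≠ 0 := by simpa using h
      rw [mul_div_mul_right _ _ this]
  have hre : 0 < ((starRingEnd ℂ) (f w) * Q).re ∧ Q ≠ 0 ∧ f w ≠ 0 := by
    have h := hpos (by rw [hquot, Complex.div_ofReal_im, Complex.conj_im, hang]; simp)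
    have hQ0 : Q ≠ 0 := by rintro h0; simp [h0] at h
    have hf0 : f w ≠ 0 := by rintro h0; simp [h0] at h
    refine ⟨?_, hQ0, hf0⟩
    rw [hquot, Complex.div_ofReal_re, Complex.conj_re] at h
    exact (div_pos_iff_of_pos_right (by positivity)).mp h
  obtain ⟨hre, hQ0, hfw0⟩ := hre
  have hfwp : 0 < ‖f w‖ := norm_pos_iff.mpr hfw0
  have hval : ((starRingEnd ℂ) (f w) * Q).re = ‖f w‖ * ‖Q‖ := by
    rw [← RCLike.norm_conj (f w), ← norm_mul]
    exact ((Complex.abs_re_eq_norm.mpr hang).symm ▸ (abs_of_pos hre).symm)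
  have hrad : HasDerivAt (fun s : ℝ => ‖f (s * w)‖ - c * (1 - (1 - s * ‖w‖) ^ n))
      (‖Q‖ - c * (n * (1 - ‖w‖) ^ (n - 1) * ‖w‖)) 1 := by
    have h1 : HasDerivAt (fun s : ℝ => f (s * w)) Q 1 := by
      have h2 := ((hf (((1 : ℝ) : ℂ) * w)).comp ((1 : ℝ) : ℂ)
        ((hasDerivAt_id ((1 : ℝ) : ℂ)).mul_const w)).comp_ofReal
      refine h2.congr_deriv ?_
      simp only [Complex.ofReal_one, one_mul, ← hD, hQ]
      ring
    have h2 : HasDerivAt (fun s : ℝ => ‖f (s * w)‖) ‖Q‖ 1 := by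
      have h3 := h1.norm_sq.sqrt (by simpa using hfw0)
      simp only [Real.sqrt_sq (norm_nonneg _), Complex.inner, Complex.ofReal_one, one_mul,
        mul_comm Q, hval] at h3
      refine h3.congr_deriv ?_
      field_simp
    have h3 : HasDerivAt (fun s : ℝ => 1 - (1 - s * ‖w‖) ^ n)
        (n * (1 - ‖w‖) ^ (n - 1) * ‖w‖) 1 := by
      have h4 := ((((hasDerivAt_id (1 : ℝ)).mul_const ‖w‖).const_sub 1).pow n).const_sub 1
      refine h4.congr_deriv ?_
      simp
    exact h2.sub (h3.const_mul c)
  have hle : ‖Q‖ - c * (n * (1 - ‖w‖) ^ (n - 1) * ‖w‖) ≤ 0 := by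
    have hlocal : IsLocalMinOn (fun s : ℝ => ‖f (s * w)‖ - c * (1 - (1 - s * ‖w‖) ^ n))
        (Set.Icc 0 1) 1 := by
      refine IsMinOn.localize fun s hs => ?_
      have hns : ‖(s : ℂ) * w‖ = s * ‖w‖ := by
        rw [norm_mul, Complex.norm_of_nonneg hs.1]
      have := hmin (s * w) (by rw [hns]; nlinarith [hs.1, hs.2])
      rw [hns] at this
      simpa using this
    have := hlocal.hasFDerivWithinAt_nonneg (y := -1) hrad.hasFDerivAt.hasFDerivWithinAt
      (mem_posTangentConeAt_of_segment_subset (by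
        rw [segment_symm, segment_eq_Icc] <;> norm_num))
    simp at this
    linarith
  have hQn : ‖Q‖ = ‖w‖ * n * ‖D‖ := by
    rw [hQ, norm_mul, norm_mul, Complex.norm_natCast, mul_assoc]
  rw [hQn] at hle
  have : 0 < ‖w‖ * n := by positivity
  refine le_of_mul_le_mul_left ?_ this
  linarith

/-- Growth bound for a polynomial whose critical points lie outside the open unit disc. -/
theorem growth_le_norm {n : ℕ} (hn : 3 ≤ n) {f : ℂ → ℂ} {S : Multiset ℂ}
    (hcard : S.card = n - 1) (hS : ∀ ξ ∈ S, 1 ≤ ‖ξ‖) (hf0 : f 0 = 0)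
    (hf : ∀ t, HasDerivAt f (n * (S.map fun ξ => t - ξ).prod) t) {L : ℝ} (hL0 : 0 ≤ L)
    (hL : L ≤ Real.sin (π / n)) (hL1 : L < 1) {w : ℂ} (hw : ‖w‖ ≤ L) :
    1 - (1 - ‖w‖) ^ n ≤ ‖f w‖ := by
  have key : ∀ c : ℝ, c < 1 → c * (1 - (1 - ‖w‖) ^ n) ≤ ‖f w‖ := by
    intro c hc
    have hfc : Continuous f := continuous_iff_continuousAt.mpr fun t => (hf t).continuousAt
    obtain ⟨w₀, hw₀, hmin⟩ := (isCompact_closedBall (0 : ℂ) L).exists_isMinOn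
      ⟨0, by simpa using hL0⟩
      (f := fun v => ‖f v‖ - c * (1 - (1 - ‖v‖) ^ n)) (by fun_prop)
    rw [mem_closedBall_zero_iff] at hw₀
    have hmin' : ∀ v : ℂ, ‖v‖ ≤ L →
        ‖f w₀‖ - c * (1 - (1 - ‖w₀‖) ^ n) ≤ ‖f v‖ - c * (1 - (1 - ‖v‖) ^ n) :=
      fun v hv => hmin (mem_closedBall_zero_iff.mpr hv)
    rcases eq_or_ne w₀ 0 with rfl | h
    · have := hmin' w hw
      simp [hf0] at this
      linarith
    · exfalso
      have h1 := norm_deriv_le_of_isMinOn hn hcard hS hf0 hf hL h hw₀ hmin'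
      have hpos : 0 < 1 - ‖w₀‖ := by linarith
      have h2 := pow_card_le_norm_prod (S := S) (f := fun ξ => w₀ - ξ) hpos.le fun ξ hξ => by
        linarith [hS ξ hξ, norm_sub_norm_le ξ w₀, norm_sub_rev ξ w₀]
      rw [hcard] at h2
      have : 0 < (1 - ‖w₀‖) ^ (n - 1) := by positivity
      nlinarith
  have hcont : Filter.Tendsto (fun c : ℝ => c * (1 - (1 - ‖w‖) ^ n)) (nhdsWithin 1 (Set.Iio 1))
      (nhds (1 * (1 - (1 - ‖w‖) ^ n))) :=
    (Continuous.tendsto (by fun_prop) 1).mono_left nhdsWithin_le_nhds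
  rw [one_mul] at hcont
  exact le_of_tendsto hcont (eventually_nhdsWithin_of_forall key)

/-- Equality in the growth bound forces all critical points to coincide. -/
theorem eq_of_norm_le_growth {n : ℕ} (hn : 3 ≤ n) {f : ℂ → ℂ} {S : Multiset ℂ}
    (hcard : S.card = n - 1) (hS : ∀ ξ ∈ S, 1 ≤ ‖ξ‖) (hf0 : f 0 = 0)
    (hf : ∀ t, HasDerivAt f (n * (S.map fun ξ => t - ξ).prod) t) {w : ℂ} (hw0 : w ≠ 0)
    (hw : ‖w‖ ≤ Real.sin (π / n)) (hw1 : ‖w‖ < 1) (hle : ‖f w‖ ≤ 1 - (1 - ‖w‖) ^ n) :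
    ∀ ξ ∈ S, ξ = w / ‖w‖ := by
  have h1 := norm_deriv_le_of_isMinOn (c := 1) hn hcard hS hf0 hf hw hw0 le_rfl fun v hv => by
    have := growth_le_norm hn hcard hS hf0 hf (norm_nonneg w) hw hw1 hv
    linarith
  rw [one_mul, ← hcard] at h1
  have hpos : 0 < 1 - ‖w‖ := by linarith
  intro ξ hξ
  have h2 := norm_eq_of_norm_prod_le (f := fun ξ => w - ξ) hpos (fun ξ hξ => by
    linarith [hS ξ hξ, norm_sub_norm_le ξ w, norm_sub_rev ξ w]) h1 ξ hξ
  have hwp : (‖w‖ : ℂ) ≠ 0 := by simpa using hw0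
  have h3 : ‖ξ‖ = 1 := by
    linarith [hS ξ hξ, norm_sub_norm_le ξ w, norm_sub_rev ξ w]
  rw [eq_div_iff hwp, ← sub_eq_zero, ← Complex.normSq_eq_zero]
  have e1 : Complex.normSq (w - ξ) = (1 - ‖w‖) ^ 2 := by rw [Complex.normSq_eq_norm_sq, h2]
  have e2 : Complex.normSq ξ = 1 := by rw [Complex.normSq_eq_norm_sq, h3, one_pow]
  have e3 : Complex.normSq w = ‖w‖ ^ 2 := Complex.normSq_eq_norm_sq w
  rw [Complex.normSq_apply] at e1 e2 e3 ⊢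
  simp only [Complex.sub_re, Complex.sub_im, Complex.mul_re, Complex.mul_im, Complex.ofReal_re,
    Complex.ofReal_im] at e1 ⊢
  linear_combination ‖w‖ * e1 + (‖w‖ ^ 2 - ‖w‖) * e2 + (1 - ‖w‖) * e3

/-- The points of a circle of radius `1` that form a regular polygon cannot all lie in the closed
unit disc if one of them lies in the open disc. -/
theorem exists_one_lt_norm_add {n : ℕ} (hn : 2 ≤ n) {c d : ℂ} (hd : ‖d‖ = 1)
    (hcd : ‖c + d‖ < 1) : ∃ x : ℂ, x ^ n = d ^ n ∧ 1 < ‖c + x‖ := by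
  by_contra! H
  set ω : ℂ := Complex.exp (2 * π * Complex.I / n) with hω
  have hprim : IsPrimitiveRoot ω n := Complex.isPrimitiveRoot_exp n (by omega)
  have hsum := hprim.geom_sum_eq_zero (by omega)
  have hωn : ‖ω‖ = 1 := hprim.norm'_eq_one (by omega)
  have hexp : ∀ k : ℕ, ‖c + d * ω ^ k‖ ^ 2 =
      ‖c‖ ^ 2 + 1 + 2 * ((starRingEnd ℂ) c * d * ω ^ k).re := by
    intro k
    have h1 : ‖d * ω ^ k‖ = 1 := by rw [norm_mul, norm_pow, hd, hωn]; simp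
    have h2 : Complex.normSq (d * ω ^ k) = 1 := by rw [Complex.normSq_eq_norm_sq, h1, one_pow]
    rw [← Complex.normSq_eq_norm_sq, Complex.normSq_add, h2, Complex.normSq_eq_norm_sq, mul_assoc,
      ← Complex.conj_re (c * _), map_mul, Complex.conj_conj]
  have hle : ∀ k ∈ Finset.range n, ‖c + d * ω ^ k‖ ^ 2 ≤ 1 := fun k _ => by
    refine pow_le_one₀ (norm_nonneg _) (H _ ?_)
    rw [mul_pow, ← pow_mul, mul_comm k, pow_mul, hprim.pow_eq_one, one_pow, mul_one]
  have hlt := Finset.sum_lt_sum hle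
    ⟨0, Finset.mem_range.mpr (by omega), by
      rw [pow_zero, mul_one]; exact pow_lt_one₀ (norm_nonneg _) hcd two_ne_zero⟩
  simp only [hexp, Finset.sum_add_distrib, ← Finset.mul_sum, ← Complex.re_sum, hsum] at hlt
  simp at hlt
  have : 0 ≤ (n : ℝ) * ‖c‖ ^ 2 := by positivity
  linarith

theorem stmt_1 (n : ℕ) (hn : 2 ≤ n) (a : ℝ) (ha0 : 0 < a) (ha1 : a < 1)
    (z : ℕ → ℂ) (hz : ∀ k ∈ Finset.range (n - 1), ‖z k‖ ≤ 1)
    (p : Polynomial ℂ)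
    (hp : p = (X - C (a : ℂ)) * ∏ k ∈ Finset.range (n - 1), (X - C (z k)))
    (hρ : ∀ ζ : ℂ, p.derivative.eval ζ = 0 → 1 ≤ ‖ζ - (a : ℂ)‖)
    (lam : ℝ) (hlam0 : 0 < lam) (hlam : lam ≤ Real.sin (Real.pi / n))
    (w : ℂ) (hw : ‖w - (a : ℂ)‖ = lam) :
    1 - (1 - lam) ^ n < ‖p.eval w‖ := by
  have hanorm : ‖(a : ℂ)‖ = a := Complex.norm_of_nonneg ha0.le
  have hpa : p.eval (a : ℂ) = 0 := by rw [hp]; simp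
  have hroot : ∀ x : ℂ, p.eval x = 0 → ‖x‖ ≤ 1 := by
    intro x hx
    rw [hp, eval_mul, eval_prod, mul_eq_zero, Finset.prod_eq_zero_iff] at hx
    rcases hx with hx | ⟨k, hk, hx⟩
    · rw [eval_sub, eval_X, eval_C, sub_eq_zero] at hx
      rw [hx, hanorm]; exact ha1.le
    · rw [eval_sub, eval_X, eval_C, sub_eq_zero] at hx
      rw [hx]; exact hz k hk
  rcases eq_or_lt_of_le hn with rfl | hn3
  · have hz0 : ‖z 0‖ ≤ 1 := hz 0 (by simp)
    have hcrit := hρ ((a + z 0) / 2) (by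
      rw [hp]
      simp [derivative_mul]
      ring)
    have h1 : (a + z 0) / 2 - (a : ℂ) = (z 0 - a) / 2 := by ring
    rw [h1, norm_div, Complex.norm_ofNat] at hcrit
    have := norm_sub_le (z 0) (a : ℂ)
    linarith
  have hprodmonic : (∏ k ∈ Finset.range (n - 1), (X - C (z k))).Monic :=
    monic_prod_of_monic _ _ fun k _ => monic_X_sub_C _
  have hmonic : p.Monic := hp ▸ (monic_X_sub_C _).mul hprodmonic
  have hdeg : p.natDegree = n := by
    rw [hp, (monic_X_sub_C _).natDegree_mul hprodmonic, natDegree_X_sub_C,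
      natDegree_prod_of_monic _ _ fun k _ => monic_X_sub_C _]
    simp
    omega
  have hnC : (n : ℂ) ≠ 0 := by norm_cast; omega
  have hder0 : p.derivative ≠ 0 := by
    intro h
    have := derivative_eq_zero.mp h
    omega
  have hsplit := IsAlgClosed.splits p.derivative
  have hddeg : p.derivative.natDegree = n - 1 := by rw [natDegree_derivative, hdeg]
  have hlead : p.derivative.leadingCoeff = n := by
    rw [leadingCoeff, hddeg, coeff_derivative, show n - 1 + 1 = n by omega]
    have : p.coeff n = 1 := by rw [← hdeg]; exact hmonic.coeff_natDegree
    rw [this, Nat.cast_sub (by omega)]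
    push_cast; ring
  set S : Multiset ℂ := p.derivative.roots.map fun ζ => ζ - a with hSdef
  have hcard : S.card = n - 1 := by
    rw [hSdef, Multiset.card_map, ← hsplit.natDegree_eq_card_roots, hddeg]
  have hS : ∀ ξ ∈ S, 1 ≤ ‖ξ‖ := by
    intro ξ hξ
    obtain ⟨ζ, hζ, rfl⟩ := Multiset.mem_map.mp hξ
    exact hρ ζ ((mem_roots hder0).mp hζ)
  have hderiv : ∀ t : ℂ, p.derivative.eval (t + a) = n * (S.map fun ξ => t - ξ).prod := by
    intro t
    rw [hsplit.eval_eq_prod_roots, hlead, hSdef, Multiset.map_map]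
    congr 3
    funext ζ
    simp only [Function.comp_apply]
    ring
  have hf : ∀ t, HasDerivAt (fun t : ℂ => p.eval (t + a))
      (n * (S.map fun ξ => t - ξ).prod) t := by
    intro t
    have h1 := (p.hasDerivAt (t + a)).comp t ((hasDerivAt_id t).add_const (a : ℂ))
    exact h1.congr_deriv (by rw [mul_one, hderiv])
  have hlam1 : lam < 1 := by
    refine hlam.trans_lt ?_
    rw [← Real.sin_pi_div_two]
    have : (3 : ℝ) ≤ n := by exact_mod_cast hn3
    refine Real.sin_lt_sin_of_lt_of_le_pi_div_two ?_ le_rfl ?_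
    · have : 0 ≤ π / n := by positivity
      linarith [Real.pi_pos]
    · exact div_lt_div_of_pos_left Real.pi_pos (by norm_num) (by linarith)
  by_contra! hle
  have hwa : w - a ≠ 0 := by
    rw [← norm_pos_iff, hw]; exact hlam0
  have heq := eq_of_norm_le_growth hn3 hcard hS (by simpa using hpa) hf hwa (hw ▸ hlam)
    (hw ▸ hlam1) (by simpa [hw] using hle)
  set u : ℂ := (w - a) / ‖w - a‖ with hu
  have hun : ‖u‖ = 1 := by
    rw [hu, norm_div, Complex.norm_real, norm_norm, div_self (norm_ne_zero_iff.mpr hwa)]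
  have hSrep := Multiset.eq_replicate.mpr ⟨hcard, heq⟩
  have hpow : p - (X - C (a + u)) ^ n = C ((p - (X - C (a + u)) ^ n).coeff 0) := by
    refine eq_C_of_derivative_eq_zero (Polynomial.funext fun x => ?_)
    have h1 := hderiv (x - a)
    rw [hSrep, Multiset.map_replicate, Multiset.prod_replicate, sub_add_cancel] at h1
    rw [derivative_sub, eval_sub, h1, derivative_X_sub_C_pow]
    simp
    ring
  have heval : ∀ x : ℂ, p.eval (a + u + x) = x ^ n - (-u) ^ n := by
    intro x
    have h1 := congrArg (eval (a + u + x)) hpow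
    have h2 := congrArg (eval (a : ℂ)) hpow
    simp only [eval_sub, eval_pow, eval_X, eval_C, hpa, add_sub_cancel_left,
      sub_add_cancel_left, zero_sub] at h1 h2
    rw [← h2] at h1
    linear_combination h1
  obtain ⟨x, hx, hx1⟩ := exists_one_lt_norm_add hn (c := a + u) (d := -u) (by simpa using hun)
    (by simpa [abs_of_pos ha0] using ha1)
  exact absurd (hroot _ (by rw [heval, hx, sub_self])) (not_le.mpr hx1)
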